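/- Let j ∈ ℕ and let f : ℝ → ℝ be j times continuously differentiable. Then sup_{x ∈ [0,1]} | f^{(j)}(x) − (d^j/dx^j) B_n(f)(x) | → 0 as n → ∞; that is, the j-th derivatives of the Bernstein polynomials of f converge uniformly on [0,1] to the j-th derivative of f. -/

import Mathlib

/-- The `n`-th Bernstein polynomial of `f : ℝ → ℝ`. -/
noncomputable def bern (n : ℕ) (f : ℝ → ℝ) (x : ℝ) : ℝ :=
  ∑ k ∈ Finset.range (n + 1), (n.choose k : ℝ) * f ((k : ℝ) / n) * x ^ k * (1 - x) ^ (n - k)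

/-- The Bernstein-form polynomial of degree at most `m` with coefficients `a 0, …, a m`. -/
noncomputable def bernsteinSum (m : ℕ) (a : ℕ → ℝ) : Polynomial ℝ :=
  ∑ k ∈ Finset.range (m + 1), Polynomial.C (a k) * bernsteinPolynomial ℝ m k

open Filter Topology Polynomial

lemma eval_bernsteinSum (m : ℕ) (a : ℕ → ℝ) (x : ℝ) :
    (bernsteinSum m a).eval x =
      ∑ k ∈ Finset.range (m + 1), a k * (bernsteinPolynomial ℝ m k).eval x := by
  simp [bernsteinSum, eval_finsetSum]

lemma bern_eq_eval_bernsteinSum (n : ℕ) (f : ℝ → ℝ) :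
    bern n f = fun x => (bernsteinSum n fun k => f (k / n)).eval x := by
  funext x
  simp only [bern, eval_bernsteinSum, bernsteinPolynomial]
  refine Finset.sum_congr rfl fun k _ => ?_
  simp
  ring

lemma bernsteinSum_sub (m : ℕ) (a b : ℕ → ℝ) :
    bernsteinSum m (fun k => a k - b k) = bernsteinSum m a - bernsteinSum m b := by
  simp [bernsteinSum, sub_mul]

lemma bernsteinSum_const_mul (m : ℕ) (c : ℝ) (a : ℕ → ℝ) :
    bernsteinSum m (fun k => c * a k) = C c * bernsteinSum m a := by
  simp [bernsteinSum, Finset.mul_sum, mul_assoc]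

lemma derivative_bernsteinSum (m : ℕ) (a : ℕ → ℝ) :
    derivative (bernsteinSum (m + 1) a) = C ((m + 1 : ℕ) : ℝ) * bernsteinSum m (fwdDiff 1 a) := by
  have shift : ∑ k ∈ Finset.range (m + 1), C (a (k + 1)) * bernsteinPolynomial ℝ m (k + 1) =
      ∑ k ∈ Finset.range (m + 1), C (a k) * bernsteinPolynomial ℝ m k -
        C (a 0) * bernsteinPolynomial ℝ m 0 := by
    have h := Finset.sum_range_succ' (fun k => C (a k) * bernsteinPolynomial ℝ m k) (m + 1)
    rw [Finset.sum_range_succ, bernsteinPolynomial.eq_zero_of_lt ℝ (Nat.lt_succ_self m)] at h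
    rw [eq_sub_iff_add_eq, ← h, mul_zero, add_zero]
  rw [bernsteinSum, Finset.sum_range_succ', derivative_add, derivative_sum]
  simp only [derivative_C_mul, bernsteinPolynomial.derivative_succ,
    bernsteinPolynomial.derivative_zero, Nat.add_sub_cancel, bernsteinSum, fwdDiff, C_sub, sub_mul,
    mul_sub, Finset.sum_sub_distrib, mul_left_comm (C (a _)), ← Finset.mul_sum, shift]
  simp
  ring

lemma iterate_derivative_bernsteinSum (m j : ℕ) (a : ℕ → ℝ) :
    derivative^[j] (bernsteinSum (m + j) a) =
      C ((m + j).descFactorial j : ℝ) * bernsteinSum m ((fwdDiff 1)^[j] a) := by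
  induction j generalizing a with
  | zero => simp
  | succ j ih =>
    rw [Function.iterate_succ_apply, ← add_assoc, derivative_bernsteinSum,
      iterate_derivative_C_mul, ih, Nat.succ_descFactorial_succ, Function.iterate_succ_apply,
      Nat.cast_mul, C_mul, mul_assoc]

lemma iteratedDeriv_polynomial_eval (p : Polynomial ℝ) (j : ℕ) :
    iteratedDeriv j (fun x => p.eval x) = fun x => (derivative^[j] p).eval x := by
  induction j with
  | zero => simp
  | succ j ih =>
    rw [iteratedDeriv_succ, ih, Function.iterate_succ_apply']
    funext x
    exact Polynomial.deriv _

lemma abs_eval_bernsteinSum_le {m : ℕ} {a : ℕ → ℝ} {c x : ℝ} (hx : x ∈ Set.Icc (0 : ℝ) 1)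
    (ha : ∀ k ≤ m, |a k| ≤ c) : |(bernsteinSum m a).eval x| ≤ c := by
  have nonneg (k : ℕ) : 0 ≤ (bernsteinPolynomial ℝ m k).eval x := by
    have h₁ : 0 ≤ 1 - x := sub_nonneg.2 hx.2
    have h₀ := hx.1
    simp only [bernsteinPolynomial, eval_mul, eval_pow, eval_natCast, eval_X, eval_sub, eval_one]
    positivity
  have sum_one : ∑ k ∈ Finset.range (m + 1), (bernsteinPolynomial ℝ m k).eval x = 1 := by
    rw [← eval_finsetSum, bernsteinPolynomial.sum, eval_one]
  calc |(bernsteinSum m a).eval x|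
      ≤ ∑ k ∈ Finset.range (m + 1), |a k * (bernsteinPolynomial ℝ m k).eval x| := by
        rw [eval_bernsteinSum]
        exact Finset.abs_sum_le_sum_abs _ _
    _ ≤ ∑ k ∈ Finset.range (m + 1), c * (bernsteinPolynomial ℝ m k).eval x := by
        refine Finset.sum_le_sum fun k hk => ?_
        rw [abs_mul, abs_of_nonneg (nonneg k)]
        exact mul_le_mul_of_nonneg_right (ha k (Finset.mem_range_succ_iff.1 hk)) (nonneg k)
    _ = c := by rw [← Finset.mul_sum, sum_one, mul_one]

lemma fwdDiff_one_iter_comp_mul (f : ℝ → ℝ) (h : ℝ) (j k : ℕ) :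
    ((fwdDiff 1)^[j] fun i : ℕ => f (i * h)) k = ((fwdDiff h)^[j] f) (k * h) := by
  induction j generalizing f with
  | zero => rfl
  | succ j ih =>
    rw [Function.iterate_succ_apply, Function.iterate_succ_apply, ← ih]
    have hΔ : (fwdDiff 1 fun i : ℕ => f (i * h)) = fun i : ℕ => fwdDiff h f (i * h) := by
      funext i
      simp [fwdDiff, add_mul]
    rw [hΔ]

/-- Mean value theorem for iterated forward differences. -/
lemma exists_fwdDiff_iter_eq_iteratedDeriv {j : ℕ} {f : ℝ → ℝ} (hf : ContDiff ℝ j f) {h : ℝ}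
    (hh : 0 < h) (y : ℝ) :
    ∃ ξ ∈ Set.Icc y (y + j * h), ((fwdDiff h)^[j] f) y = h ^ j * iteratedDeriv j f ξ := by
  induction j generalizing f with
  | zero => exact ⟨y, by simp, by simp⟩
  | succ j ih =>
    have hfj : ContDiff ℝ j f := hf.of_le (by exact_mod_cast Nat.le_succ j)
    have hfh : ContDiff ℝ j fun z => f (z + h) := hfj.comp (by fun_prop)
    obtain ⟨ξ, hξ, e⟩ := ih (f := fwdDiff h f) (hfh.sub hfj)
    have hd : Differentiable ℝ (iteratedDeriv j f) :=
      hf.differentiable_iteratedDeriv j (by exact_mod_cast Nat.lt_succ_self j)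
    obtain ⟨η, hη, e'⟩ := exists_deriv_eq_slope (iteratedDeriv j f) (lt_add_of_pos_right ξ hh)
      hd.continuous.continuousOn hd.differentiableOn
    refine ⟨η, ⟨hξ.1.trans hη.1.le, ?_⟩, ?_⟩
    · have := hξ.2
      have := hη.2
      push_cast
      linarith
    · have e₂ : iteratedDeriv j (fwdDiff h f) ξ = iteratedDeriv j f (ξ + h) - iteratedDeriv j f ξ := by
        have := iteratedDeriv_fun_sub (x := ξ) hfh.contDiffAt hfj.contDiffAt
        rw [iteratedDeriv_comp_add_const] at this
        exact this
      rw [Function.iterate_succ_apply, e, e₂, iteratedDeriv_succ, e', add_sub_cancel_left]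
      field_simp
      ring

lemma eventually_abs_eval_bernsteinSum_sub_lt {g : ℝ → ℝ} (hg : ContinuousOn g (Set.Icc 0 1))
    {ε : ℝ} (hε : 0 < ε) :
    ∀ᶠ m : ℕ in atTop, ∀ x ∈ Set.Icc (0 : ℝ) 1,
      |(bernsteinSum m fun k => g (k / m)).eval x - g x| < ε := by
  let G : C(unitInterval, ℝ) := ⟨fun x => g x, hg.domRestrict⟩
  filter_upwards [(Metric.tendsto_nhds.1 (bernsteinApproximation_uniform G)) ε hε] with m hm x hx
  have h := (ContinuousMap.dist_lt_iff hε).1 hm ⟨x, hx⟩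
  rw [Real.dist_eq, bernsteinApproximation.apply] at h
  have hsum : (bernsteinSum m fun k => g (k / m)).eval x =
      ∑ k : Fin (m + 1), bernstein m k ⟨x, hx⟩ • G (bernstein.z k) := by
    rw [eval_bernsteinSum, Finset.sum_range]
    refine Finset.sum_congr rfl fun k _ => ?_
    have hG : G (bernstein.z k) = g (k / m) := rfl
    simp [bernstein_apply, bernsteinPolynomial, hG, mul_comm]
  rw [hsum]
  exact h

lemma tendsto_descFactorial_div_pow (j : ℕ) :
    Tendsto (fun n : ℕ => (n.descFactorial j : ℝ) / (n : ℝ) ^ j) atTop (𝓝 1) := by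
  refine (Asymptotics.isEquivalent_iff_tendsto_one ?_).1 (isEquivalent_descFactorial j)
  filter_upwards [eventually_ne_atTop 0] with n hn
  positivity

/-- The `j`-th derivative of a Bernstein polynomial in Bernstein form, its coefficients being
values of the `j`-th derivative of `f` near the nodes. -/
lemma exists_iteratedDeriv_bern_eq {j m : ℕ} (hm : 0 < m) {f : ℝ → ℝ} (hf : ContDiff ℝ j f) :
    ∃ ξ : ℕ → ℝ, (∀ k ≤ m, ξ k ∈ Set.Icc (0 : ℝ) 1 ∧ |ξ k - k / m| ≤ j / (m + j : ℕ)) ∧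
      ∀ x, iteratedDeriv j (bern (m + j) f) x =
        ((m + j).descFactorial j : ℝ) / ((m + j : ℕ) : ℝ) ^ j *
          (bernsteinSum m fun k => iteratedDeriv j f (ξ k)).eval x := by
  set n := m + j with hn
  have hn₀ : (0 : ℝ) < n := by exact_mod_cast (by omega : 0 < n)
  have hm₀ : (0 : ℝ) < m := by exact_mod_cast hm
  have hnr : (n : ℝ) = m + j := by rw [hn]; push_cast; ring
  choose ξ hξ e using fun k : ℕ =>
    exists_fwdDiff_iter_eq_iteratedDeriv hf (inv_pos.2 hn₀) ((k : ℝ) * (n : ℝ)⁻¹)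
  refine ⟨ξ, fun k hk => ?_, fun x => ?_⟩
  · have hkr : (k : ℝ) ≤ m := by exact_mod_cast hk
    have h₁ : (k : ℝ) / n ≤ ξ k := (hξ k).1
    have h₂ : ξ k ≤ (k : ℝ) / n + j / n := (hξ k).2
    have h₃ : (k : ℝ) / n ≤ k / m := by
      gcongr
      exact Nat.le_add_right m j
    have h₄ : (k : ℝ) / m ≤ k / n + j / n := by
      rw [← add_div, div_le_div_iff₀ hm₀ hn₀, hnr]
      nlinarith [mul_le_mul_of_nonneg_right hkr j.cast_nonneg (α := ℝ)]
    have h₅ : (k : ℝ) / n + j / n ≤ 1 := by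
      rw [← add_div, div_le_one hn₀, hnr]
      linarith
    have h₀ : (0 : ℝ) ≤ k / n := by positivity
    exact ⟨⟨h₀.trans h₁, h₂.trans h₅⟩, abs_le.2 ⟨by linarith, by linarith⟩⟩
  · have hΔ : ((fwdDiff 1)^[j] fun k : ℕ => f (k / n)) =
        fun k => ((n : ℝ)⁻¹) ^ j * iteratedDeriv j f (ξ k) := by
      funext k
      rw [← e k, ← fwdDiff_one_iter_comp_mul]
      rfl
    rw [bern_eq_eval_bernsteinSum, iteratedDeriv_polynomial_eval, iterate_derivative_bernsteinSum,
      ← hn, hΔ, bernsteinSum_const_mul]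
    simp only [eval_mul, eval_C]
    rw [inv_pow, ← mul_assoc, div_eq_mul_inv]

/-- If `f` is `j` times continuously differentiable, then the `j`-th derivatives of the
Bernstein polynomials of `f` converge uniformly on `[0,1]` to the `j`-th derivative of `f`. -/
theorem iteratedDeriv_bernstein_tendstoUniformlyOn (j : ℕ) (f : ℝ → ℝ)
    (hf : ContDiff ℝ (j : ℕ∞) f) :
    TendstoUniformlyOn (fun n => iteratedDeriv j (bern n f)) (iteratedDeriv j f)
      Filter.atTop (Set.Icc 0 1) := by
  have hf' : ContDiff ℝ j f := by exact_mod_cast hf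
  set g := iteratedDeriv j f with hg
  have hgc : Continuous g := hf'.continuous_iteratedDeriv j le_rfl
  rw [Metric.tendstoUniformlyOn_iff]
  intro ε hε
  have hε₃ : 0 < ε / 3 := by positivity
  obtain ⟨M, hM⟩ := isCompact_Icc.exists_bound_of_continuousOn
    (hgc.continuousOn (s := Set.Icc (0 : ℝ) 1))
  obtain ⟨δ, hδ, hgδ⟩ := Metric.uniformContinuousOn_iff.1
    (isCompact_Icc.uniformContinuousOn_of_continuous (hgc.continuousOn (s := Set.Icc (0 : ℝ) 1)))
    (ε / 3) hε₃
  have hc : Tendsto (fun n : ℕ => |(n.descFactorial j : ℝ) / (n : ℝ) ^ j - 1| * M) atTop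
      (𝓝 0) := by
    simpa using (((tendsto_descFactorial_div_pow j).sub_const 1).abs.mul_const M)
  filter_upwards [hc.eventually_lt_const hε₃, eventually_gt_atTop j,
    (tendsto_const_div_atTop_nhds_zero_nat (j : ℝ)).eventually_lt_const hδ,
    (tendsto_sub_atTop_nat j).eventually
      (eventually_abs_eval_bernsteinSum_sub_lt hgc.continuousOn hε₃)] with n hcn hjn hnδ hB x hx
  obtain ⟨m, rfl⟩ : ∃ m, n = m + j := ⟨n - j, by omega⟩
  have hm : 0 < m := by omega
  rw [Nat.add_sub_cancel] at hB
  obtain ⟨ξ, hξ, e⟩ := exists_iteratedDeriv_bern_eq hm hf'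
  rw [e, ← hg, dist_comm, Real.dist_eq]
  set c := ((m + j).descFactorial j : ℝ) / ((m + j : ℕ) : ℝ) ^ j
  set p := (bernsteinSum m fun k => g (ξ k)).eval x with hp
  set q := (bernsteinSum m fun k => g (k / m)).eval x with hq
  have hpM : |p| ≤ M := abs_eval_bernsteinSum_le hx fun k hk => hM _ (hξ k hk).1
  have hpq : |p - q| ≤ ε / 3 := by
    rw [hp, hq, ← eval_sub, ← bernsteinSum_sub]
    refine abs_eval_bernsteinSum_le hx fun k hk => ?_
    have hkm : (k : ℝ) / m ∈ Set.Icc (0 : ℝ) 1 :=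
      ⟨by positivity, div_le_one_of_le₀ (by exact_mod_cast hk) m.cast_nonneg⟩
    exact (hgδ _ (hξ k hk).1 _ hkm ((hξ k hk).2.trans_lt hnδ)).le
  calc |c * p - g x| = |(c - 1) * p + (p - q) + (q - g x)| := by ring_nf
    _ ≤ |(c - 1) * p| + |p - q| + |q - g x| := abs_add_three _ _ _
    _ ≤ |c - 1| * M + |p - q| + |q - g x| := by
        rw [abs_mul]
        gcongr
    _ < ε := by linarith [hB x hx]
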